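/- (Theorems 4.3 and 4.6) Assume that at every point (u,v) the second fundamental form of x is not equal to −(ξ/2) times the first fundamental form, i.e. it is not the case that e = −(ξ/2)E, f = −(ξ/2)F and g = −(ξ/2)G simultaneously, where ξ = 2η/‖x − c‖². Then the following are equivalent: (i) η(u,v) = 0 for all (u,v) (equivalently, conjugate and asymptotic directions of x are invariant under the tangent map of the inversion); (ii) the third fundamental forms agree, P̃ = P, Q̃ = Q and R̃ = R at every point; (iii) U_y = −U_x at every point. -/

import Mathlib

noncomputable section
open scoped RealInnerProductSpace

/-- ℝ³ as Euclidean 3-space. -/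
abbrev E3 : Type := EuclideanSpace ℝ (Fin 3)

/-- The cross product on ℝ³. -/
def cross (a b : E3) : E3 :=
  (WithLp.equiv 2 (Fin 3 → ℝ)).symm
    ![a 1 * b 2 - a 2 * b 1, a 2 * b 0 - a 0 * b 2, a 0 * b 1 - a 1 * b 0]

/-- The inversion of ℝ³ with center `c` and radius `r`. -/
def inv3 (c : E3) (r : ℝ) (p : E3) : E3 :=
  c + (r ^ 2 / ‖p - c‖ ^ 2) • (p - c)

/-- Partial derivative in the first variable. -/
def pu {E : Type*} [NormedAddCommGroup E] [NormedSpace ℝ E]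
    (x : ℝ → ℝ → E) (u v : ℝ) : E :=
  deriv (fun t => x t v) u

/-- Partial derivative in the second variable. -/
def pv {E : Type*} [NormedAddCommGroup E] [NormedSpace ℝ E]
    (x : ℝ → ℝ → E) (u v : ℝ) : E :=
  deriv (fun t => x u t) v

/-- The unit normal of a patch. -/
def unormal (x : ℝ → ℝ → E3) (u v : ℝ) : E3 :=
  ‖cross (pu x u v) (pv x u v)‖⁻¹ • cross (pu x u v) (pv x u v)

/-- The conformal factor λ of the inversion along the patch. -/
def lam (c : E3) (r : ℝ) (x : ℝ → ℝ → E3) (u v : ℝ) : ℝ :=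
  r ^ 2 / ‖x u v - c‖ ^ 2

/-- The support-type function η = ⟨U_x, x − c⟩. -/
def eta (c : E3) (x : ℝ → ℝ → E3) (u v : ℝ) : ℝ :=
  ⟪unormal x u v, x u v - c⟫

/-- First fundamental form coefficient E. -/
def FFE (x : ℝ → ℝ → E3) (u v : ℝ) : ℝ := ⟪pu x u v, pu x u v⟫
/-- First fundamental form coefficient F. -/
def FFF (x : ℝ → ℝ → E3) (u v : ℝ) : ℝ := ⟪pu x u v, pv x u v⟫
/-- First fundamental form coefficient G. -/
def FFG (x : ℝ → ℝ → E3) (u v : ℝ) : ℝ := ⟪pv x u v, pv x u v⟫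
/-- Second fundamental form coefficient e. -/
def SFe (x : ℝ → ℝ → E3) (u v : ℝ) : ℝ := ⟪pu (pu x) u v, unormal x u v⟫
/-- Second fundamental form coefficient f. -/
def SFf (x : ℝ → ℝ → E3) (u v : ℝ) : ℝ := ⟪pv (pu x) u v, unormal x u v⟫
/-- Second fundamental form coefficient g. -/
def SFg (x : ℝ → ℝ → E3) (u v : ℝ) : ℝ := ⟪pv (pv x) u v, unormal x u v⟫
/-- Third fundamental form coefficient P. -/
def TFP (x : ℝ → ℝ → E3) (u v : ℝ) : ℝ := ⟪pu (unormal x) u v, pu (unormal x) u v⟫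
/-- Third fundamental form coefficient Q. -/
def TFQ (x : ℝ → ℝ → E3) (u v : ℝ) : ℝ := ⟪pu (unormal x) u v, pv (unormal x) u v⟫
/-- Third fundamental form coefficient R. -/
def TFR (x : ℝ → ℝ → E3) (u v : ℝ) : ℝ := ⟪pv (unormal x) u v, pv (unormal x) u v⟫

/-- Christoffel symbol Γ¹₁₁. -/
def Ch111 (x : ℝ → ℝ → E3) (u v : ℝ) : ℝ :=
  (FFG x u v * pu (FFE x) u v - 2 * FFF x u v * pu (FFF x) u v + FFF x u v * pv (FFE x) u v) /
    (2 * (FFE x u v * FFG x u v - FFF x u v ^ 2))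
/-- Christoffel symbol Γ²₁₁. -/
def Ch211 (x : ℝ → ℝ → E3) (u v : ℝ) : ℝ :=
  (2 * FFE x u v * pu (FFF x) u v - FFE x u v * pv (FFE x) u v - FFF x u v * pu (FFE x) u v) /
    (2 * (FFE x u v * FFG x u v - FFF x u v ^ 2))
/-- Christoffel symbol Γ¹₁₂. -/
def Ch112 (x : ℝ → ℝ → E3) (u v : ℝ) : ℝ :=
  (FFG x u v * pv (FFE x) u v - FFF x u v * pu (FFG x) u v) /
    (2 * (FFE x u v * FFG x u v - FFF x u v ^ 2))
/-- Christoffel symbol Γ²₁₂. -/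
def Ch212 (x : ℝ → ℝ → E3) (u v : ℝ) : ℝ :=
  (FFE x u v * pu (FFG x) u v - FFF x u v * pv (FFE x) u v) /
    (2 * (FFE x u v * FFG x u v - FFF x u v ^ 2))
/-- Christoffel symbol Γ¹₂₂. -/
def Ch122 (x : ℝ → ℝ → E3) (u v : ℝ) : ℝ :=
  (2 * FFG x u v * pv (FFF x) u v - FFG x u v * pu (FFG x) u v - FFF x u v * pv (FFG x) u v) /
    (2 * (FFE x u v * FFG x u v - FFF x u v ^ 2))
/-- Christoffel symbol Γ²₂₂. -/
def Ch222 (x : ℝ → ℝ → E3) (u v : ℝ) : ℝ :=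
  (FFE x u v * pv (FFG x) u v - 2 * FFF x u v * pv (FFF x) u v + FFF x u v * pu (FFG x) u v) /
    (2 * (FFE x u v * FFG x u v - FFF x u v ^ 2))

/-- The tangent map of the inversion at `p`. -/
def phiStar (c : E3) (r : ℝ) (p : E3) (w : E3) : E3 :=
  (r ^ 2 / ‖p - c‖ ^ 2) • w - (2 * r ^ 2 * ⟪p - c, w⟫ / ‖p - c‖ ^ 4) • (p - c)

theorem inner_eq_coords (a b : E3) : ⟪a, b⟫ = a 0 * b 0 + a 1 * b 1 + a 2 * b 2 := by
  simp [PiLp.inner_apply, Fin.sum_univ_three]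
  ring

@[simp] theorem cross_apply_zero (a b : E3) : cross a b 0 = a 1 * b 2 - a 2 * b 1 := rfl
@[simp] theorem cross_apply_one (a b : E3) : cross a b 1 = a 2 * b 0 - a 0 * b 2 := rfl
@[simp] theorem cross_apply_two (a b : E3) : cross a b 2 = a 0 * b 1 - a 1 * b 0 := rfl

theorem inner_cross_left (a b : E3) : ⟪cross a b, a⟫ = 0 := by
  simp only [inner_eq_coords, cross_apply_zero, cross_apply_one, cross_apply_two]
  ring

theorem inner_cross_right (a b : E3) : ⟪cross a b, b⟫ = 0 := by
  simp only [inner_eq_coords, cross_apply_zero, cross_apply_one, cross_apply_two]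
  ring

/-- The cross product of two vectors transformed by a multiple of the reflection in the plane
orthogonal to `d`. -/
theorem cross_reflect (d a b : E3) (l k : ℝ) (hk : k * ⟪d, d⟫ = 2) :
    cross (l • (a - (k * ⟪d, a⟫) • d)) (l • (b - (k * ⟪d, b⟫) • d)) =
      l ^ 2 • (-cross a b + (k * ⟪d, cross a b⟫) • d) := by
  rw [inner_eq_coords] at hk
  ext i
  fin_cases i
  · simp [inner_eq_coords]
    linear_combination (-l ^ 2 * (a 1 * b 2 - a 2 * b 1)) * hk
  · simp [inner_eq_coords]
    linear_combination (-l ^ 2 * (a 2 * b 0 - a 0 * b 2)) * hk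
  · simp [inner_eq_coords]
    linear_combination (-l ^ 2 * (a 0 * b 1 - a 1 * b 0)) * hk

theorem norm_neg_add_reflect (d n : E3) (k : ℝ) (hk : k * ⟪d, d⟫ = 2) :
    ‖-n + (k * ⟪d, n⟫) • d‖ = ‖n‖ := by
  rw [← sq_eq_sq₀ (norm_nonneg _) (norm_nonneg _), ← real_inner_self_eq_norm_sq,
    ← real_inner_self_eq_norm_sq]
  simp only [inner_add_left, inner_add_right, inner_neg_left, inner_neg_right,
    real_inner_smul_left, real_inner_smul_right, real_inner_comm d n]
  linear_combination k * ⟪d, n⟫ ^ 2 * hk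

/-- The inner product of two derivatives of the inverted unit normal, expressed through those of
the original one. -/
theorem inner_deriv_normal_inversion (d a b p q : E3) (k α β : ℝ)
    (hα : α * ⟪d, d⟫ = 2 * (⟪a, d⟫ - k * ⟪p, d⟫))
    (hβ : β * ⟪d, d⟫ = 2 * (⟪b, d⟫ - k * ⟪q, d⟫)) :
    ⟪-a + (α • d + k • p), -b + (β • d + k • q)⟫ =
      ⟪a, b⟫ - k * (⟪a, q⟫ + ⟪b, p⟫) + k ^ 2 * ⟪p, q⟫ := by
  simp only [inner_add_left, inner_add_right, inner_neg_left, inner_neg_right,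
    real_inner_smul_left, real_inner_smul_right]
  rw [real_inner_comm b d, real_inner_comm q d, real_inner_comm b p]
  linear_combination (β / 2) * hα + (α / 2) * hβ

theorem hasDerivAt_inv3 (c : E3) (r : ℝ) {γ : ℝ → E3} {w : E3} {t : ℝ}
    (hγ : HasDerivAt γ w t) (hc : γ t ≠ c) :
    HasDerivAt (fun s => inv3 c r (γ s)) (phiStar c r (γ t) w) t := by
  have hd : ‖γ t - c‖ ≠ 0 := norm_ne_zero_iff.2 (sub_ne_zero.2 hc)
  have h1 := hγ.sub_const c
  have h := ((((hasDerivAt_const t (r ^ 2)).fun_div h1.norm_sq (pow_ne_zero 2 hd)).fun_smul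
    h1).const_add c)
  refine h.congr_deriv ?_
  rw [phiStar, sub_eq_add_neg (_ • w), ← neg_smul]
  congr 2
  field_simp
  ring

theorem phiStar_eq_smul_reflect (c : E3) (r : ℝ) (p w : E3) :
    phiStar c r p w =
      (r ^ 2 / ‖p - c‖ ^ 2) • (w - (2 / ‖p - c‖ ^ 2 * ⟪p - c, w⟫) • (p - c)) := by
  rw [phiStar, smul_sub _ w, smul_smul]
  congr 2
  ring

theorem exists_hasDerivAt_normal_inversion (c : E3) {n γ : ℝ → E3} {a w : E3} {t : ℝ}
    (hn : HasDerivAt n a t) (hγ : HasDerivAt γ w t) (hc : γ t ≠ c) (hnw : ⟪n t, w⟫ = 0) :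
    ∃ α : ℝ, α * ⟪γ t - c, γ t - c⟫ =
        2 * (⟪a, γ t - c⟫ - 2 * ⟪n t, γ t - c⟫ / ‖γ t - c‖ ^ 2 * ⟪w, γ t - c⟫) ∧
      HasDerivAt (fun s => -n s + (2 * ⟪n s, γ s - c⟫ / ‖γ s - c‖ ^ 2) • (γ s - c))
        (-a + (α • (γ t - c) + (2 * ⟪n t, γ t - c⟫ / ‖γ t - c‖ ^ 2) • w)) t := by
  have hd : ‖γ t - c‖ ≠ 0 := norm_ne_zero_iff.2 (sub_ne_zero.2 hc)
  have h1 := hγ.sub_const c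
  have hk := ((hn.inner ℝ h1).const_mul 2).fun_div h1.norm_sq (pow_ne_zero 2 hd)
  refine ⟨_, ?_, (hn.fun_neg.fun_add (hk.fun_smul h1)).congr_deriv (by rw [add_comm (_ • w)])⟩
  rw [hnw, real_inner_self_eq_norm_sq, real_inner_comm (γ t - c) w]
  field_simp
  ring

section Partial

variable {E : Type*} [NormedAddCommGroup E] [NormedSpace ℝ E] {x : ℝ → ℝ → E}

theorem hasDerivAt_pu (hx : Differentiable ℝ (fun p : ℝ × ℝ => x p.1 p.2)) (u v : ℝ) :
    HasDerivAt (fun t => x t v) (pu x u v) u :=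
  DifferentiableAt.hasDerivAt <|
    (hx (u, v)).comp u (f := fun t : ℝ => (t, v)) (by fun_prop)

theorem hasDerivAt_pv (hx : Differentiable ℝ (fun p : ℝ × ℝ => x p.1 p.2)) (u v : ℝ) :
    HasDerivAt (fun t => x u t) (pv x u v) v :=
  DifferentiableAt.hasDerivAt <|
    (hx (u, v)).comp v (f := fun t : ℝ => (u, t)) (by fun_prop)

theorem pu_eq_fderiv (hx : Differentiable ℝ (fun p : ℝ × ℝ => x p.1 p.2)) (u v : ℝ) :
    pu x u v = fderiv ℝ (fun p : ℝ × ℝ => x p.1 p.2) (u, v) (1, 0) :=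
  ((hx (u, v)).hasFDerivAt.comp_hasDerivAt u (f := fun t : ℝ => (t, v))
    ((hasDerivAt_id u).prodMk (hasDerivAt_const u v))).deriv

theorem pv_eq_fderiv (hx : Differentiable ℝ (fun p : ℝ × ℝ => x p.1 p.2)) (u v : ℝ) :
    pv x u v = fderiv ℝ (fun p : ℝ × ℝ => x p.1 p.2) (u, v) (0, 1) :=
  ((hx (u, v)).hasFDerivAt.comp_hasDerivAt v (f := fun t : ℝ => (u, t))
    ((hasDerivAt_const v u).prodMk (hasDerivAt_id v))).deriv

theorem contDiff_pu (hx : ContDiff ℝ (⊤ : ℕ∞) (fun p : ℝ × ℝ => x p.1 p.2)) :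
    ContDiff ℝ (⊤ : ℕ∞) (fun p : ℝ × ℝ => pu x p.1 p.2) := by
  simp only [pu_eq_fderiv (hx.differentiable (by simp))]
  exact (hx.fderiv_right (m := (⊤ : ℕ∞)) (by simp)).clm_apply contDiff_const

theorem contDiff_pv (hx : ContDiff ℝ (⊤ : ℕ∞) (fun p : ℝ × ℝ => x p.1 p.2)) :
    ContDiff ℝ (⊤ : ℕ∞) (fun p : ℝ × ℝ => pv x p.1 p.2) := by
  simp only [pv_eq_fderiv (hx.differentiable (by simp))]
  exact (hx.fderiv_right (m := (⊤ : ℕ∞)) (by simp)).clm_apply contDiff_const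

theorem pu_pv_comm (hx : ContDiff ℝ (⊤ : ℕ∞) (fun p : ℝ × ℝ => x p.1 p.2)) (u v : ℝ) :
    pu (pv x) u v = pv (pu x) u v := by
  have hd := hx.differentiable (by simp)
  have h2 : Differentiable ℝ (fderiv ℝ (fun p : ℝ × ℝ => x p.1 p.2)) :=
    (hx.fderiv_right (m := (⊤ : ℕ∞)) (by simp)).differentiable (by simp)
  rw [pu_eq_fderiv ((contDiff_pv hx).differentiable (by simp)),
    pv_eq_fderiv ((contDiff_pu hx).differentiable (by simp))]
  simp only [pu_eq_fderiv hd, pv_eq_fderiv hd]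
  rw [fderiv_clm_apply (h2 _) (by fun_prop), fderiv_clm_apply (h2 _) (by fun_prop)]
  simpa using (hx.contDiffAt (x := (u, v))).isSymmSndFDerivAt
    (by simpa using WithTop.coe_le_coe.2 (le_top : (2 : ℕ∞) ≤ ⊤)) (1, 0) (0, 1)

end Partial

theorem differentiable_unormal {x : ℝ → ℝ → E3}
    (hx : ContDiff ℝ (⊤ : ℕ∞) (fun p : ℝ × ℝ => x p.1 p.2))
    (hreg : ∀ u v : ℝ, cross (pu x u v) (pv x u v) ≠ 0) :
    Differentiable ℝ (fun p : ℝ × ℝ => unormal x p.1 p.2) := by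
  have hu (i : Fin 3) : Differentiable ℝ (fun p : ℝ × ℝ => pu x p.1 p.2 i) :=
    differentiable_euclidean.1 ((contDiff_pu hx).differentiable (by simp)) i
  have hv (i : Fin 3) : Differentiable ℝ (fun p : ℝ × ℝ => pv x p.1 p.2 i) :=
    differentiable_euclidean.1 ((contDiff_pv hx).differentiable (by simp)) i
  have hN : Differentiable ℝ (fun p : ℝ × ℝ => cross (pu x p.1 p.2) (pv x p.1 p.2)) := by
    rw [differentiable_euclidean]
    intro i
    fin_cases i
    · exact ((hu 1).mul (hv 2)).sub ((hu 2).mul (hv 1))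
    · exact ((hu 2).mul (hv 0)).sub ((hu 0).mul (hv 2))
    · exact ((hu 0).mul (hv 1)).sub ((hu 1).mul (hv 0))
  exact ((hN.norm ℝ fun p => hreg p.1 p.2).inv
    fun p => norm_ne_zero_iff.2 (hreg p.1 p.2)).smul hN

theorem inner_unormal_pu (x : ℝ → ℝ → E3) (u v : ℝ) : ⟪unormal x u v, pu x u v⟫ = 0 := by
  rw [unormal, real_inner_smul_left, inner_cross_left, mul_zero]

theorem inner_unormal_pv (x : ℝ → ℝ → E3) (u v : ℝ) : ⟪unormal x u v, pv x u v⟫ = 0 := by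
  rw [unormal, real_inner_smul_left, inner_cross_right, mul_zero]

/-- Differentiating an orthogonality relation along a curve. -/
theorem inner_deriv_eq_neg_of_orthogonal {n w : ℝ → E3} {a b : E3} {t : ℝ}
    (hn : HasDerivAt n a t) (hw : HasDerivAt w b t) (h : ∀ s, ⟪n s, w s⟫ = 0) :
    ⟪a, w t⟫ = -⟪b, n t⟫ := by
  have h1 := hn.inner ℝ hw
  simp only [h] at h1
  have h2 := h1.unique (hasDerivAt_const t (0 : ℝ))
  rw [real_inner_comm (n t) b]
  linarith

/-- The unit normal of the inverse patch. -/
theorem unormal_inversion {c : E3} {r : ℝ} (hr : 0 < r) {x y : ℝ → ℝ → E3}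
    (hx : Differentiable ℝ (fun p : ℝ × ℝ => x p.1 p.2)) (hxc : ∀ u v : ℝ, x u v ≠ c)
    (hy : ∀ u v : ℝ, y u v = inv3 c r (x u v)) (u v : ℝ) :
    unormal y u v =
      -unormal x u v + (2 * eta c x u v / ‖x u v - c‖ ^ 2) • (x u v - c) := by
  have hd : ‖x u v - c‖ ≠ 0 := norm_ne_zero_iff.2 (sub_ne_zero.2 (hxc u v))
  have hk : 2 / ‖x u v - c‖ ^ 2 * ⟪x u v - c, x u v - c⟫ = 2 := by
    rw [real_inner_self_eq_norm_sq]
    field_simp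
  have hyu : pu y u v = phiStar c r (x u v) (pu x u v) := by
    simp only [pu, hy]
    exact (hasDerivAt_inv3 c r (hasDerivAt_pu hx u v) (hxc u v)).deriv
  have hyv : pv y u v = phiStar c r (x u v) (pv x u v) := by
    simp only [pv, hy]
    exact (hasDerivAt_inv3 c r (hasDerivAt_pv hx u v) (hxc u v)).deriv
  have hl : 0 < (r ^ 2 / ‖x u v - c‖ ^ 2) ^ 2 := by positivity
  rw [eta, unormal, unormal, hyu, hyv, phiStar_eq_smul_reflect, phiStar_eq_smul_reflect,
    cross_reflect _ _ _ _ _ hk, norm_smul, norm_neg_add_reflect _ _ _ hk,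
    Real.norm_of_nonneg hl.le, smul_smul, mul_inv, mul_right_comm, inv_mul_cancel₀ hl.ne',
    one_mul, smul_add, smul_neg, smul_smul, real_inner_smul_left,
    real_inner_comm (x u v - c)]
  congr 2
  ring

/-- The third fundamental form of the inverse patch is `III + 2 ξ II + ξ² I`. -/
theorem third_form_inversion {c : E3} {r : ℝ} (hr : 0 < r) {x y : ℝ → ℝ → E3}
    (hx : ContDiff ℝ (⊤ : ℕ∞) (fun p : ℝ × ℝ => x p.1 p.2)) (hxc : ∀ u v : ℝ, x u v ≠ c)
    (hy : ∀ u v : ℝ, y u v = inv3 c r (x u v))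
    (hreg : ∀ u v : ℝ, cross (pu x u v) (pv x u v) ≠ 0) (u v k : ℝ)
    (hk : 2 * eta c x u v / ‖x u v - c‖ ^ 2 = k) :
    TFP y u v = TFP x u v + 2 * k * SFe x u v + k ^ 2 * FFE x u v ∧
      TFQ y u v = TFQ x u v + 2 * k * SFf x u v + k ^ 2 * FFF x u v ∧
      TFR y u v = TFR x u v + 2 * k * SFg x u v + k ^ 2 * FFG x u v := by
  have hd := hx.differentiable (by simp)
  have hn := differentiable_unormal hx hreg
  have hu := (contDiff_pu hx).differentiable (by simp)
  have hv := (contDiff_pv hx).differentiable (by simp)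
  have e1 : ⟪pu (unormal x) u v, pu x u v⟫ = -SFe x u v :=
    inner_deriv_eq_neg_of_orthogonal (n := fun s => unormal x s v)
      (hasDerivAt_pu hn u v) (hasDerivAt_pu hu u v)
      fun s => inner_unormal_pu x s v
  have e2 : ⟪pv (unormal x) u v, pu x u v⟫ = -SFf x u v :=
    inner_deriv_eq_neg_of_orthogonal (hasDerivAt_pv hn u v) (hasDerivAt_pv hu u v)
      fun s => inner_unormal_pu x u s
  have e3 : ⟪pu (unormal x) u v, pv x u v⟫ = -SFf x u v := by
    rw [SFf, ← pu_pv_comm hx]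
    exact inner_deriv_eq_neg_of_orthogonal (n := fun s => unormal x s v)
      (hasDerivAt_pu hn u v) (hasDerivAt_pu hv u v)
      fun s => inner_unormal_pv x s v
  have e4 : ⟪pv (unormal x) u v, pv x u v⟫ = -SFg x u v :=
    inner_deriv_eq_neg_of_orthogonal (hasDerivAt_pv hn u v) (hasDerivAt_pv hv u v)
      fun s => inner_unormal_pv x u s
  obtain ⟨α, hα, hα'⟩ := exists_hasDerivAt_normal_inversion c (hasDerivAt_pu hn u v)
    (hasDerivAt_pu hd u v) (hxc u v) (inner_unormal_pu x u v)
  obtain ⟨β, hβ, hβ'⟩ := exists_hasDerivAt_normal_inversion c (hasDerivAt_pv hn u v)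
    (hasDerivAt_pv hd u v) (hxc u v) (inner_unormal_pv x u v)
  have hU := unormal_inversion hr hd hxc hy
  have hyu : pu (unormal y) u v =
      -pu (unormal x) u v + (α • (x u v - c) + k • pu x u v) := by
    rw [← hk, pu]
    simp only [hU]
    exact hα'.deriv
  have hyv : pv (unormal y) u v =
      -pv (unormal x) u v + (β • (x u v - c) + k • pv x u v) := by
    rw [← hk, pv]
    simp only [hU]
    exact hβ'.deriv
  rw [eta] at hk
  rw [hk] at hα hβ
  simp only [TFP, TFQ, TFR, hyu, hyv]
  rw [inner_deriv_normal_inversion _ _ _ _ _ _ _ _ hα hα,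
    inner_deriv_normal_inversion _ _ _ _ _ _ _ _ hα hβ,
    inner_deriv_normal_inversion _ _ _ _ _ _ _ _ hβ hβ, e1, e2, e3, e4, FFE, FFF, FFG]
  refine ⟨?_, ?_, ?_⟩ <;> ring

theorem eta_zero_iff_third_forms_agree_iff_normals_opposite
    (c : E3) (r : ℝ) (hr : 0 < r)
    (x : ℝ → ℝ → E3)
    (hx : ContDiff ℝ (⊤ : ℕ∞) (fun p : ℝ × ℝ => x p.1 p.2))
    (hxc : ∀ u v : ℝ, x u v ≠ c)
    (y : ℝ → ℝ → E3) (hy : ∀ u v : ℝ, y u v = inv3 c r (x u v))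
    (hreg : ∀ u v : ℝ, cross (pu x u v) (pv x u v) ≠ 0)
    (hII : ∀ u v : ℝ,
      ¬ (SFe x u v = -((2 * eta c x u v / ‖x u v - c‖ ^ 2) / 2) * FFE x u v ∧
         SFf x u v = -((2 * eta c x u v / ‖x u v - c‖ ^ 2) / 2) * FFF x u v ∧
         SFg x u v = -((2 * eta c x u v / ‖x u v - c‖ ^ 2) / 2) * FFG x u v)) :
    ((∀ u v : ℝ, eta c x u v = 0) ↔
      (∀ u v : ℝ, TFP y u v = TFP x u v ∧ TFQ y u v = TFQ x u v ∧ TFR y u v = TFR x u v)) ∧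
    ((∀ u v : ℝ, TFP y u v = TFP x u v ∧ TFQ y u v = TFQ x u v ∧ TFR y u v = TFR x u v) ↔
      (∀ u v : ℝ, unormal y u v = -unormal x u v)) := by
  have hd (u v : ℝ) : ‖x u v - c‖ ≠ 0 := norm_ne_zero_iff.2 (sub_ne_zero.2 (hxc u v))
  have h12 : (∀ u v : ℝ, eta c x u v = 0) ↔
      (∀ u v : ℝ, TFP y u v = TFP x u v ∧ TFQ y u v = TFQ x u v ∧ TFR y u v = TFR x u v) := by
    refine forall₂_congr fun u v => ?_
    obtain ⟨hP, hQ, hR⟩ := third_form_inversion hr hx hxc hy hreg u v _ rfl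
    constructor
    · intro h
      simp [hP, hQ, hR, h]
    · rintro ⟨h1, h2, h3⟩
      by_contra h0
      have hk : 2 * eta c x u v / ‖x u v - c‖ ^ 2 ≠ 0 :=
        div_ne_zero (mul_ne_zero two_ne_zero h0) (pow_ne_zero 2 (hd u v))
      refine hII u v ⟨mul_left_cancel₀ hk ?_, mul_left_cancel₀ hk ?_, mul_left_cancel₀ hk ?_⟩ <;>
        linarith
  have h13 : (∀ u v : ℝ, eta c x u v = 0) ↔ (∀ u v : ℝ, unormal y u v = -unormal x u v) := by
    refine forall₂_congr fun u v => ?_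
    rw [unormal_inversion hr (hx.differentiable (by simp)) hxc hy, add_eq_left, smul_eq_zero]
    simp [hd u v, sub_ne_zero.2 (hxc u v)]
  exact ⟨h12, h12.symm.trans h13⟩
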